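/- Let G = PSL(2,ℤ) with r, u, S = {r, u, u⁻¹} as above, and let a ∈ {u, u⁻¹} with ā = a⁻¹. If g ∈ G satisfies 𝐒₂*(g) = {ra}, then S⁺(g) = {r, a}, 𝐒₂*(g·r) = {ar, rā}, and 𝐒₂*(g·a) = {aa}. -/

import Mathlib

namespace PSL2Z

abbrev SL2Z : Type := Matrix.SpecialLinearGroup (Fin 2) ℤ

/-- `PSL(2,ℤ)`: the quotient of `SL(2,ℤ)` by its center `{±I}`. -/
abbrev G : Type := SL2Z ⧸ Subgroup.center SL2Z

/-- The image in `PSL(2,ℤ)` of the matrix `[[0,1],[-1,0]]`. -/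
def r : G := QuotientGroup.mk (⟨!![0, 1; -1, 0], by norm_num [Matrix.det_fin_two_of]⟩ : SL2Z)

/-- The image in `PSL(2,ℤ)` of the matrix `[[1,1],[0,1]]`. -/
def u : G := QuotientGroup.mk (⟨!![1, 1; 0, 1], by norm_num [Matrix.det_fin_two_of]⟩ : SL2Z)

/-- The symmetric generating set `S = {r, u, u⁻¹}`. -/
def S : Set G := {r, u, u⁻¹}

/-- A word in `S`: a finite list of elements of `S`. -/
def IsWord (w : List G) : Prop := ∀ x ∈ w, x ∈ S

/-- The word norm `|g|`: the least length of a word in `S` representing `g`. -/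
noncomputable def wordNorm (g : G) : ℕ :=
  sInf {n | ∃ w : List G, IsWord w ∧ w.prod = g ∧ w.length = n}

/-- A geodesic for `g`: a word in `S` representing `g` of length `|g|`. -/
def IsGeodesic (g : G) (w : List G) : Prop :=
  IsWord w ∧ w.prod = g ∧ w.length = wordNorm g

/-- `𝐒ₙ(g)`: the set of suffixes of length `n` of geodesics for `g`. -/
def Suf (n : ℕ) (g : G) : Set (List G) :=
  {v | v.length = n ∧ ∃ w : List G, IsGeodesic g w ∧ v <:+ w}

open Classical in
/-- `𝐒₂*(g)`: `𝐒₂(g)` if nonempty, otherwise `𝐒₁(g)` (which is `∅` exactly when `g = 1`). -/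
noncomputable def Suf2Star (g : G) : Set (List G) :=
  if (Suf 2 g).Nonempty then Suf 2 g else Suf 1 g

/-- `S⁺(g) = {s ∈ S : |g·s| = |g| + 1}`. -/
def Splus (g : G) : Set G := {s ∈ S | wordNorm (g * s) = wordNorm g + 1}

/-- The matrix defining `r`. -/
def rot : SL2Z := ⟨!![0, 1; -1, 0], by norm_num [Matrix.det_fin_two_of]⟩

/-- The upper unipotent matrix with off-diagonal entry `e`. -/
def upper (e : ℤ) : SL2Z := ⟨!![1, e; 0, 1], by simp [Matrix.det_fin_two_of]⟩

/-- The lower unipotent matrix with off-diagonal entry `e`. -/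
def lower (e : ℤ) : SL2Z := ⟨!![1, 0; e, 1], by simp [Matrix.det_fin_two_of]⟩

@[simp] theorem coe_rot : (rot : Matrix (Fin 2) (Fin 2) ℤ) = !![0, 1; -1, 0] := rfl

@[simp] theorem coe_upper (e : ℤ) :
    (upper e : Matrix (Fin 2) (Fin 2) ℤ) = !![1, e; 0, 1] := rfl

@[simp] theorem coe_lower (e : ℤ) :
    (lower e : Matrix (Fin 2) (Fin 2) ℤ) = !![1, 0; e, 1] := rfl

theorem r_eq_mk : r = QuotientGroup.mk rot := rfl

theorem u_eq_mk : u = QuotientGroup.mk (upper 1) := rfl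

theorem r_mul_r : r * r = 1 := by
  rw [r_eq_mk, ← QuotientGroup.mk_mul, QuotientGroup.eq_one_iff, Matrix.SpecialLinearGroup.mem_center_iff]
  refine ⟨-1, by norm_num, ?_⟩
  ext i j
  fin_cases i <;> fin_cases j <;> simp

theorem mk_eq_mk_of_eq_neg {A B : SL2Z} (h : A = -B) :
    (QuotientGroup.mk A : G) = QuotientGroup.mk B := by
  rw [QuotientGroup.eq, Matrix.SpecialLinearGroup.mem_center_iff]
  refine ⟨-1, by norm_num, ?_⟩
  subst h
  rw [show (-B)⁻¹ * B = -1 by rw [inv_mul_eq_iff_eq_mul]; simp]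
  ext i j
  fin_cases i <;> fin_cases j <;> simp

theorem exists_sign_of_mk_eq_mk {A B : SL2Z}
    (h : (QuotientGroup.mk A : G) = QuotientGroup.mk B) :
    ∃ c : ℤ, c * c = 1 ∧ ∀ i j, B.1 i j = c * A.1 i j := by
  rw [QuotientGroup.eq, Matrix.SpecialLinearGroup.mem_center_iff] at h
  obtain ⟨c, hc, h⟩ := h
  refine ⟨c, by simpa [sq] using hc, fun i j => ?_⟩
  have hB : B.1 = A.1 * (A⁻¹ * B).1 := by
    rw [← Matrix.SpecialLinearGroup.coe_mul, mul_inv_cancel_left]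
  rw [hB, ← h, Matrix.scalar_apply, Matrix.mul_diagonal, mul_comm]

theorem mk_upper_neg (e : ℤ) :
    (QuotientGroup.mk (upper (-e)) : G) = (QuotientGroup.mk (upper e))⁻¹ := by
  rw [eq_inv_iff_mul_eq_one, ← QuotientGroup.mk_mul, ← QuotientGroup.mk_one]
  congr 1
  ext i j
  fin_cases i <;> fin_cases j <;> simp

theorem r_mul_upper_inv_mul_r (e : ℤ) :
    r * (QuotientGroup.mk (upper e))⁻¹ * r = (QuotientGroup.mk (lower e) : G) := by
  rw [← mk_upper_neg, r_eq_mk, ← QuotientGroup.mk_mul, ← QuotientGroup.mk_mul]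
  apply mk_eq_mk_of_eq_neg
  ext i j
  fin_cases i <;> fin_cases j <;> simp

theorem r_inv : r⁻¹ = r := inv_eq_of_mul_eq_one_left r_mul_r

theorem u_braid : u * r * u = r * u⁻¹ * r := by
  have h := r_mul_upper_inv_mul_r 1
  rw [← u_eq_mk] at h
  rw [h, r_eq_mk, u_eq_mk, ← QuotientGroup.mk_mul, ← QuotientGroup.mk_mul]
  apply mk_eq_mk_of_eq_neg
  ext i j
  fin_cases i <;> fin_cases j <;> simp

theorem exists_upper {a : G} (ha : a ∈ ({u, u⁻¹} : Set G)) :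
    ∃ e : ℤ, e * e = 1 ∧ a = QuotientGroup.mk (upper e) := by
  rcases ha with rfl | rfl
  · exact ⟨1, rfl, rfl⟩
  · exact ⟨-1, rfl, (mk_upper_neg 1).symm⟩

theorem inv_mem {a : G} (ha : a ∈ ({u, u⁻¹} : Set G)) : a⁻¹ ∈ ({u, u⁻¹} : Set G) := by
  rcases ha with rfl | rfl <;> simp

theorem S_eq {a : G} (ha : a ∈ ({u, u⁻¹} : Set G)) : S = {r, a, a⁻¹} := by
  rcases ha with rfl | rfl
  · rfl
  · rw [inv_inv, Set.pair_comm u⁻¹ u]; rfl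

theorem braid {a : G} (ha : a ∈ ({u, u⁻¹} : Set G)) : a * r * a = r * a⁻¹ * r := by
  rcases ha with rfl | rfl
  · exact u_braid
  · have h := congrArg (·⁻¹) u_braid
    simpa [mul_inv_rev, r_inv, mul_assoc] using h

/-- The last letter of the word coded by a (reversed) list, `true` for the empty word. -/
def lastLetter : List Bool → Bool
  | [] => true
  | d :: _ => d

@[simp] theorem lastLetter_cons (d : Bool) (w : List Bool) : lastLetter (d :: w) = d := rfl

/-- The generator `a` or `a⁻¹`. -/
def letter (a : G) (d : Bool) : G := if d then a else a⁻¹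

/-- The number of letters of the alternating word coded by a (reversed) list: each letter counts
once, and each change of letter costs one more. -/
def cost : List Bool → ℕ
  | [] => 0
  | d :: w => cost w + if lastLetter w = d then 1 else 2

/-- The product of elementary matrices with natural entries coded by a (reversed) list. -/
def coeff : List Bool → Matrix (Fin 2) (Fin 2) ℕ
  | [] => 1
  | d :: w => coeff w * if d then !![1, 1; 0, 1] else !![1, 0; 1, 1]

/-- The product of elementary matrices with parameter `e` coded by a (reversed) list. -/
def elemProd (e : ℤ) : List Bool → SL2Z
  | [] => 1
  | d :: w => elemProd e w * if d then upper e else lower e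

theorem coeff_det (w : List Bool) :
    coeff w 0 0 * coeff w 1 1 = coeff w 0 1 * coeff w 1 0 + 1 := by
  induction w with
  | nil => simp [coeff]
  | cons d w ih =>
    cases d <;> simp [coeff, Matrix.mul_apply, Fin.sum_univ_two] <;> linarith

theorem coeff_pos (w : List Bool) : 0 < coeff w 0 0 ∧ 0 < coeff w 1 1 := by
  have h := coeff_det w
  constructor <;> rw [Nat.pos_iff_ne_zero] <;> intro h0 <;> simp [h0] at h

theorem elemProd_apply {e : ℤ} (he : e * e = 1) (w : List Bool) :
    (elemProd e w).1 0 0 = coeff w 0 0 ∧ (elemProd e w).1 0 1 = e * coeff w 0 1 ∧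
      (elemProd e w).1 1 0 = e * coeff w 1 0 ∧ (elemProd e w).1 1 1 = coeff w 1 1 := by
  induction w with
  | nil => simp [coeff, elemProd]
  | cons d w ih =>
    obtain ⟨h1, h2, h3, h4⟩ := ih
    cases d <;>
      simp [coeff, elemProd, Matrix.mul_apply, Fin.sum_univ_two, h1, h2, h3, h4] <;>
      grind

theorem coeff_injective : Function.Injective coeff := by
  intro w
  induction w with
  | nil =>
    rintro (_ | ⟨d, w'⟩) h
    · rfl
    · have h01 := congrFun₂ h 0 1
      have h10 := congrFun₂ h 1 0
      have := coeff_pos w'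
      cases d <;> simp [coeff, Matrix.mul_apply, Fin.sum_univ_two] at h01 h10 <;> omega
  | cons d w ih =>
    rintro (_ | ⟨d', w'⟩) h
    · have h01 := congrFun₂ h 0 1
      have h10 := congrFun₂ h 1 0
      have := coeff_pos w
      cases d <;> simp [coeff, Matrix.mul_apply, Fin.sum_univ_two] at h01 h10 <;> omega
    · have h00 := congrFun₂ h 0 0
      have h01 := congrFun₂ h 0 1
      have h10 := congrFun₂ h 1 0
      have h11 := congrFun₂ h 1 1
      have hw := coeff_pos w
      have hw' := coeff_pos w'
      cases d <;> cases d' <;>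
        simp [coeff, Matrix.mul_apply, Fin.sum_univ_two] at h00 h01 h10 h11
      · have hc : coeff w = coeff w' := by
          ext i j
          fin_cases i <;> fin_cases j <;> simp <;> omega
        rw [ih hc]
      · omega
      · omega
      · have hc : coeff w = coeff w' := by
          ext i j
          fin_cases i <;> fin_cases j <;> simp <;> omega
        rw [ih hc]

theorem mk_elemProd_injective {e e' : ℤ} (he : e * e = 1) (he' : e' * e' = 1) {w w' : List Bool}
    (h : (QuotientGroup.mk (elemProd e w) : G) = QuotientGroup.mk (elemProd e' w')) :
    w = w' := by
  obtain ⟨c, hc, h⟩ := exists_sign_of_mk_eq_mk h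
  obtain ⟨h1, h2, h3, h4⟩ := elemProd_apply he w
  obtain ⟨h1', h2', h3', h4'⟩ := elemProd_apply he' w'
  have k1 := h 0 0
  have k2 := h 0 1
  have k3 := h 1 0
  have k4 := h 1 1
  rw [h1, h1'] at k1
  rw [h2, h2'] at k2
  rw [h3, h3'] at k3
  rw [h4, h4'] at k4
  apply coeff_injective
  ext i j
  rcases mul_self_eq_one_iff.mp he with rfl | rfl <;>
    rcases mul_self_eq_one_iff.mp he' with rfl | rfl <;>
    rcases mul_self_eq_one_iff.mp hc with rfl | rfl <;> fin_cases i <;> fin_cases j <;> simp <;> omega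

theorem mk_elemProd_ne_mul_r {e e' : ℤ} (he : e * e = 1) (he' : e' * e' = 1) (w w' : List Bool) :
    (QuotientGroup.mk (elemProd e w) : G) ≠ QuotientGroup.mk (elemProd e' w') * r := by
  rw [r_eq_mk, ← QuotientGroup.mk_mul]
  intro h
  obtain ⟨c, hc, h⟩ := exists_sign_of_mk_eq_mk h
  obtain ⟨h1, h2, h3, h4⟩ := elemProd_apply he w
  obtain ⟨h1', h2', h3', h4'⟩ := elemProd_apply he' w'
  have k1 := h 0 0
  have k2 := h 0 1
  have k3 := h 1 0
  have k4 := h 1 1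
  simp [Matrix.mul_apply, Fin.sum_univ_two, h1, h2, h3, h4, h1', h2', h3', h4'] at k1 k2 k3 k4
  have := coeff_pos w
  have := coeff_pos w'
  rcases mul_self_eq_one_iff.mp he with rfl | rfl <;>
    rcases mul_self_eq_one_iff.mp he' with rfl | rfl <;>
    rcases mul_self_eq_one_iff.mp hc with rfl | rfl <;> omega

theorem letter_not (a : G) (d : Bool) : letter a (!d) = (letter a d)⁻¹ := by
  cases d <;> simp [letter]

/-- `x` is the closer endpoint of an edge labelled `r` beyond which geodesics continue by `b`;
`n` is the length of `x`. -/
inductive Node : G → G → ℕ → Prop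
  | root {b : G} (hb : b ∈ ({u, u⁻¹} : Set G)) : Node 1 b 0
  | straight {x b : G} {n : ℕ} (h : Node x b n) : Node (x * b) b (n + 1)
  | turn {x b : G} {n : ℕ} (h : Node x b n) : Node (x * r * b⁻¹) b⁻¹ (n + 2)

theorem Node.mem {x b : G} {n : ℕ} (h : Node x b n) : b ∈ ({u, u⁻¹} : Set G) := by
  induction h with
  | root hb => exact hb
  | straight _ ih => exact ih
  | turn _ ih => exact inv_mem ih

theorem Node.exists_elemProd {x b : G} {n : ℕ} (h : Node x b n) :
    ∃ e : ℤ, e * e = 1 ∧ ∃ w : List Bool,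
      x * (if lastLetter w then 1 else r) = QuotientGroup.mk (elemProd e w) ∧
      b = letter (QuotientGroup.mk (upper e)) (lastLetter w) ∧ n = cost w := by
  induction h with
  | root hb =>
    obtain ⟨e, he, rfl⟩ := exists_upper hb
    exact ⟨e, he, [], by simp [elemProd, lastLetter], rfl, rfl⟩
  | straight _ ih =>
    obtain ⟨e, he, w, hx, rfl, rfl⟩ := ih
    refine ⟨e, he, lastLetter w :: w, ?_, rfl, by simp [cost]⟩
    rw [elemProd, QuotientGroup.mk_mul, ← hx]
    have hl := r_mul_upper_inv_mul_r e
    cases h : lastLetter w <;> simp [letter, ← hl, mul_assoc]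
    rw [← mul_assoc r r, r_mul_r, one_mul]
  | turn _ ih =>
    obtain ⟨e, he, w, hx, rfl, rfl⟩ := ih
    refine ⟨e, he, (!lastLetter w) :: w, ?_, (letter_not _ _).symm, by simp [cost]⟩
    rw [elemProd, QuotientGroup.mk_mul, ← hx]
    have hl := r_mul_upper_inv_mul_r e
    cases h : lastLetter w <;> simp [letter, ← hl, mul_assoc]

/-- `g` is spelled with `n` letters by a node, possibly followed by `r`. -/
def HasForm (g : G) (n : ℕ) : Prop :=
  ∃ x b m, Node x b m ∧ ((g = x ∧ n = m) ∨ (g = x * r ∧ n = m + 1))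

theorem HasForm.exists_elemProd {g : G} {n : ℕ} (h : HasForm g n) :
    ∃ e : ℤ, e * e = 1 ∧ ∃ w : List Bool,
      (g = QuotientGroup.mk (elemProd e w) ∧ n = cost w + if lastLetter w then 0 else 1) ∨
      (g = QuotientGroup.mk (elemProd e w) * r ∧
        n = cost w + if lastLetter w then 1 else 0) := by
  obtain ⟨x, b, m, hx, h⟩ := h
  obtain ⟨e, he, w, hw, -, rfl⟩ := hx.exists_elemProd
  refine ⟨e, he, w, ?_⟩
  rw [← hw]
  cases hw : lastLetter w <;> simp [mul_assoc, r_mul_r] <;> tauto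

theorem HasForm.unique {g : G} {n n' : ℕ} (h : HasForm g n) (h' : HasForm g n') : n = n' := by
  obtain ⟨e, he, w, h⟩ := h.exists_elemProd
  obtain ⟨e', he', w', h'⟩ := h'.exists_elemProd
  clear * - h h' he he'
  rcases h with ⟨rfl, rfl⟩ | ⟨rfl, rfl⟩ <;> rcases h' with ⟨h', rfl⟩ | ⟨h', rfl⟩
  · rw [mk_elemProd_injective he he' h']
  · exact absurd h' (mk_elemProd_ne_mul_r he he' w w')
  · exact absurd h'.symm (mk_elemProd_ne_mul_r he' he w' w)
  · rw [mk_elemProd_injective he he' (mul_right_cancel h')]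

theorem Node.hasForm {x b : G} {n : ℕ} (h : Node x b n) : HasForm x n :=
  ⟨x, b, n, h, .inl ⟨rfl, rfl⟩⟩

theorem Node.hasForm_mul_r {x b : G} {n : ℕ} (h : Node x b n) : HasForm (x * r) (n + 1) :=
  ⟨x, b, n, h, .inr ⟨rfl, rfl⟩⟩

theorem Node.step {x b : G} {n : ℕ} (h : Node x b n) {s : G} (hs : s ∈ S) :
    ∃ n' ≤ n + 1, HasForm (x * s) n' := by
  rw [S_eq h.mem] at hs
  rcases hs with rfl | rfl | rfl
  · exact ⟨_, le_rfl, h.hasForm_mul_r⟩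
  · exact ⟨_, le_rfl, h.straight.hasForm⟩
  · cases h with
    | root hb =>
      exact ⟨1, le_rfl, by simpa using (Node.root (inv_mem hb)).straight.hasForm⟩
    | @straight _ _ m h => exact ⟨m, by omega, by simpa using h.hasForm⟩
    | @turn _ _ m h => exact ⟨m + 1, by omega, by simpa using h.hasForm_mul_r⟩

theorem Node.step_mul_r {x b : G} {n : ℕ} (h : Node x b n) {s : G} (hs : s ∈ S) :
    ∃ n' ≤ n + 2, HasForm (x * r * s) n' := by
  have hbr := braid h.mem
  rw [S_eq h.mem] at hs
  rcases hs with rfl | rfl | rfl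
  · exact ⟨n, by omega, by simpa [mul_assoc, r_mul_r] using h.hasForm⟩
  · cases h with
    | root hb =>
      exact ⟨2, le_rfl, by simpa using (Node.root (inv_mem hb)).turn.hasForm⟩
    | @straight y _ m h =>
      refine ⟨_, le_rfl, ?_⟩
      have := h.turn.hasForm_mul_r
      rwa [show y * r * s⁻¹ * r = y * s * r * s by simp only [mul_assoc] at hbr ⊢; rw [hbr]] at this
    | @turn y c m h =>
      refine ⟨m + 2, by omega, ?_⟩
      have := h.straight.hasForm_mul_r
      rwa [show y * c * r = y * r * c⁻¹ * r * c⁻¹ by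
        simp only [mul_assoc, inv_inv] at hbr ⊢; rw [hbr, ← mul_assoc r r, r_mul_r, one_mul]] at this
  · exact ⟨_, le_rfl, h.turn.hasForm⟩

theorem HasForm.step {g : G} {n : ℕ} (h : HasForm g n) {s : G} (hs : s ∈ S) :
    ∃ n' ≤ n + 1, HasForm (g * s) n' := by
  obtain ⟨x, b, m, hx, ⟨rfl, rfl⟩ | ⟨rfl, rfl⟩⟩ := h
  · exact hx.step hs
  · exact hx.step_mul_r hs

theorem IsWord.append {v w : List G} (hv : IsWord v) (hw : IsWord w) : IsWord (v ++ w) := by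
  intro x hx
  rcases List.mem_append.mp hx with h | h
  exacts [hv x h, hw x h]

theorem IsWord.singleton {s : G} (hs : s ∈ S) : IsWord [s] := by
  intro x hx
  rwa [List.mem_singleton.mp hx]

theorem r_mem : r ∈ S := by simp [S]

theorem mem_S_of_mem {a : G} (ha : a ∈ ({u, u⁻¹} : Set G)) : a ∈ S := .inr ha

theorem Node.exists_word {x b : G} {n : ℕ} (h : Node x b n) :
    ∃ w, IsWord w ∧ w.prod = x ∧ w.length = n := by
  induction h with
  | root _ => exact ⟨[], by simp [IsWord], rfl, rfl⟩
  | @straight _ b _ h ih =>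
    obtain ⟨w, hw, rfl, rfl⟩ := ih
    exact ⟨w ++ [b], hw.append (.singleton (mem_S_of_mem h.mem)), by simp, by simp⟩
  | @turn _ b _ h ih =>
    obtain ⟨w, hw, rfl, rfl⟩ := ih
    exact ⟨w ++ [r] ++ [b⁻¹],
      (hw.append (.singleton r_mem)).append (.singleton (mem_S_of_mem (inv_mem h.mem))),
      by simp [mul_assoc], by simp⟩

theorem HasForm.exists_word {g : G} {n : ℕ} (h : HasForm g n) :
    ∃ w, IsWord w ∧ w.prod = g ∧ w.length = n := by
  obtain ⟨x, b, m, hx, ⟨rfl, rfl⟩ | ⟨rfl, rfl⟩⟩ := h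
  · exact hx.exists_word
  · obtain ⟨w, hw, rfl, rfl⟩ := hx.exists_word
    exact ⟨w ++ [r], hw.append (.singleton r_mem), by simp, by simp⟩

theorem IsWord.exists_hasForm (w : List G) (hw : IsWord w) :
    ∃ n ≤ w.length, HasForm w.prod n := by
  induction w using List.reverseRecOn with
  | nil => exact ⟨0, le_rfl, (Node.root (b := u) (by simp)).hasForm⟩
  | append_singleton w s ih =>
    obtain ⟨n, hn, h⟩ := ih fun x hx => hw x (by simp [hx])
    obtain ⟨n', hn', h'⟩ := h.step (hw s (by simp))
    exact ⟨n', by simp; omega, by simpa using h'⟩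

theorem wordNorm_prod_le {w : List G} (hw : IsWord w) : wordNorm w.prod ≤ w.length :=
  Nat.sInf_le ⟨w, hw, rfl, rfl⟩

theorem HasForm.wordNorm_eq {g : G} {n : ℕ} (h : HasForm g n) : wordNorm g = n := by
  obtain ⟨w, hw, rfl, rfl⟩ := h.exists_word
  refine le_antisymm (wordNorm_prod_le hw) (le_csInf ⟨_, w, hw, rfl, rfl⟩ ?_)
  rintro _ ⟨v, hv, hvw, rfl⟩
  obtain ⟨n, hn, h'⟩ := hv.exists_hasForm
  rw [hvw] at h'
  exact h.unique h' ▸ hn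

theorem ne_r {b : G} (hb : b ∈ ({u, u⁻¹} : Set G)) : b ≠ r := by
  rintro rfl
  have h0 := (Node.root hb).hasForm.wordNorm_eq
  have h2 := (Node.root hb).straight.straight.hasForm.wordNorm_eq
  rw [one_mul, r_mul_r, h0] at h2
  omega

theorem Suf2Star_eq_of_mem {g : G} {v : List G} (h : v ∈ Suf 2 g) : Suf2Star g = Suf 2 g :=
  if_pos ⟨v, h⟩

/-- A two-letter suffix `[s, t]` of a geodesic for `g` splits off an element of norm `|g| - 2`. -/
theorem mem_Suf_two_iff {g s t : G} :
    [s, t] ∈ Suf 2 g ↔ s ∈ S ∧ t ∈ S ∧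
      ∃ h n, HasForm h n ∧ h * s * t = g ∧ wordNorm g = n + 2 := by
  constructor
  · rintro ⟨-, w, ⟨hw, rfl, hl⟩, v, rfl⟩
    have hv : IsWord v := fun x hx => hw x (by simp [hx])
    obtain ⟨n, hn, h⟩ := hv.exists_hasForm
    refine ⟨hw s (by simp), hw t (by simp), v.prod, n, h, by simp [mul_assoc], ?_⟩
    obtain ⟨v', hv', hp, rfl⟩ := h.exists_word
    have hle := wordNorm_prod_le
      ((hv'.append (.singleton (hw s (by simp)))).append (.singleton (hw t (by simp))))
    simp [hp] at hle hl ⊢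
    omega
  · rintro ⟨hs, ht, h, n, hn, rfl, hl⟩
    obtain ⟨v, hv, rfl, rfl⟩ := hn.exists_word
    exact ⟨rfl, v ++ [s] ++ [t], ⟨(hv.append (.singleton hs)).append (.singleton ht),
      by simp [mul_assoc], by simp [hl]⟩, v, by simp⟩

theorem wordNorm_lt_of_mem_Suf_two {g s t : G} (h : [s, t] ∈ Suf 2 g) :
    s ∈ S ∧ t ∈ S ∧ wordNorm (g * t⁻¹) < wordNorm g ∧
      wordNorm (g * t⁻¹ * s⁻¹) + 1 < wordNorm g := by
  obtain ⟨hs, ht, k, n, hk, rfl, hn⟩ := mem_Suf_two_iff.mp h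
  obtain ⟨n', hn', hks⟩ := hk.step hs
  rw [mul_inv_cancel_right, mul_inv_cancel_right, hn, hk.wordNorm_eq, hks.wordNorm_eq]
  exact ⟨hs, ht, by omega, by omega⟩

theorem exists_pair_of_mem_Suf_two {g : G} {v : List G} (h : v ∈ Suf 2 g) : ∃ s t, v = [s, t] :=
  List.length_eq_two.mp h.1

/-- If the last two letters of every geodesic for `g` are `r, a`, then `g` is the node reached by a
turn. -/
theorem exists_node_of_Suf2Star {a g : G} (hg : Suf2Star g = {[r, a]})
    (ha : a ∈ ({u, u⁻¹} : Set G)) : ∃ x n, Node x a⁻¹ n ∧ g = x * r * a := by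
  have hsuf : Suf 2 g = {[r, a]} := by
    rw [Suf2Star] at hg
    split_ifs at hg with h
    · exact hg
    · have h1 : [r, a] ∈ Suf 1 g := by rw [hg]; rfl
      exact absurd h1.1 (by simp)
  obtain ⟨n, hgn⟩ : ∃ n, HasForm g n := by
    obtain ⟨-, w, ⟨hw, rfl, -⟩, -⟩ : [r, a] ∈ Suf 2 g := by rw [hsuf]; rfl
    obtain ⟨n, -, h⟩ := hw.exists_hasForm
    exact ⟨n, h⟩
  have hnorm := hgn.wordNorm_eq
  have huniq : ∀ s t : G, [s, t] ∈ Suf 2 g → s = r ∧ t = a := by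
    intro s t h
    rw [hsuf] at h
    simpa using h
  have hlen : 2 ≤ n := by
    obtain ⟨-, -, -, m, -, -, h⟩ := mem_Suf_two_iff.mp (show [r, a] ∈ Suf 2 g by rw [hsuf]; rfl)
    omega
  obtain ⟨x, b, m, hx, ⟨rfl, rfl⟩ | ⟨rfl, rfl⟩⟩ := hgn
  · have hb := mem_S_of_mem hx.mem
    cases hx with
    | root => omega
    | @turn y c m hy =>
      obtain ⟨-, rfl⟩ := huniq r c⁻¹ (mem_Suf_two_iff.mpr ⟨r_mem, hb, y, m, hy.hasForm, rfl, hnorm⟩)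
      exact ⟨y, m, by rwa [inv_inv], rfl⟩
    | @straight y _ m hy =>
      exfalso
      cases hy with
      | root => omega
      | @straight z _ m hz =>
        exact ne_r hz.mem
          (huniq b b (mem_Suf_two_iff.mpr ⟨hb, hb, z, m, hz.hasForm, rfl, hnorm⟩)).1
      | @turn z c m hz =>
        exact ne_r (inv_mem hz.mem) (huniq c⁻¹ c⁻¹ (mem_Suf_two_iff.mpr
          ⟨hb, hb, z * r, m + 1, hz.hasForm_mul_r, rfl, hnorm⟩)).1
  · exfalso
    obtain ⟨w, hw, rfl, rfl⟩ := hx.exists_word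
    obtain rfl | ⟨v, s, rfl⟩ := w.eq_nil_or_concat'
    · simp at hlen
    · have h : [s, r] ∈ Suf 2 ((v ++ [s]).prod * r) :=
        ⟨rfl, v ++ [s] ++ [r], ⟨hw.append (.singleton r_mem), by simp [mul_assoc], by rw [hnorm]; simp⟩,
          v, by simp⟩
      exact ne_r ha (huniq _ _ h).2.symm

/-- If `𝐒₂*(g) = {ra}` (for `a = u` or `u⁻¹`) then `S⁺(g) = {r, a}`,
`𝐒₂*(g·r) = {ar, rā}` and `𝐒₂*(g·a) = {aa}`. -/
theorem type_ra (a : G) (ha : a ∈ ({u, u⁻¹} : Set G))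
    (g : G) (hg : Suf2Star g = ({[r, a]} : Set (List G))) :
    Splus g = {r, a} ∧
      Suf2Star (g * r) = {[a, r], [r, a⁻¹]} ∧
      Suf2Star (g * a) = {[a, a]} := by
  obtain ⟨z, m, hz, rfl⟩ := exists_node_of_Suf2Star hg ha
  have hx : Node (z * r * a) a (m + 2) := by simpa using hz.turn
  have hrr (y : G) : y * r * r = y := by rw [mul_assoc, r_mul_r, mul_one]
  have hrar (y : G) : y * r * a * r = y * a⁻¹ * r * a⁻¹ := by
    simpa [mul_assoc] using congrArg (y * ·) (braid (inv_mem ha)).symm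
  have haS := mem_S_of_mem ha
  have haS' := mem_S_of_mem (inv_mem ha)
  have n_r := hx.hasForm_mul_r.wordNorm_eq
  have n_a := hx.straight.hasForm.wordNorm_eq
  have n_aa := hx.straight.straight.hasForm.wordNorm_eq
  have n_ar := hx.straight.hasForm_mul_r.wordNorm_eq
  have n_ra' := hx.turn.hasForm.wordNorm_eq
  have n_x := hx.hasForm.wordNorm_eq
  have n_zr := hz.hasForm_mul_r.wordNorm_eq
  have n_za'ra : wordNorm (z * a⁻¹ * r * a) = m + 3 := by
    simpa using hz.straight.turn.hasForm.wordNorm_eq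
  refine ⟨?_, ?_, ?_⟩
  · ext s
    rw [Splus, Set.mem_ofPred_eq, S_eq ha]
    constructor
    · rintro ⟨rfl | rfl | rfl, h⟩
      · simp
      · simp
      · rw [mul_inv_cancel_right] at h
        omega
    · rintro (rfl | rfl)
      · exact ⟨by simp, by omega⟩
      · exact ⟨by simp, by omega⟩
  · have h1 : [a, r] ∈ Suf 2 (z * r * a * r) :=
      mem_Suf_two_iff.mpr ⟨haS, r_mem, z * r, m + 1, hz.hasForm_mul_r, rfl, n_r⟩
    have h2 : [r, a⁻¹] ∈ Suf 2 (z * r * a * r) :=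
      mem_Suf_two_iff.mpr ⟨r_mem, haS', z * a⁻¹, m + 1, hz.straight.hasForm, (hrar z).symm, n_r⟩
    rw [Suf2Star_eq_of_mem h1]
    refine subset_antisymm ?_ (Set.insert_subset h1 (Set.singleton_subset_iff.mpr h2))
    intro v hv
    obtain ⟨s, t, rfl⟩ := exists_pair_of_mem_Suf_two hv
    obtain ⟨hs, ht, h1, h2⟩ := wordNorm_lt_of_mem_Suf_two hv
    rw [S_eq ha] at hs ht
    rw [n_r] at h1 h2
    rcases ht with rfl | rfl | rfl
    · rw [r_inv, hrr] at h2
      rcases hs with rfl | rfl | rfl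
      · rw [r_inv] at h2; omega
      · simp
      · rw [inv_inv] at h2; omega
    · omega
    · rw [inv_inv, hrar, inv_mul_cancel_right] at h2
      rcases hs with rfl | rfl | rfl
      · simp
      · rw [← hrar] at h2; omega
      · rw [inv_inv] at h2; omega
  · have h1 : [a, a] ∈ Suf 2 (z * r * a * a) :=
      mem_Suf_two_iff.mpr ⟨haS, haS, z * r, m + 1, hz.hasForm_mul_r, rfl, n_a⟩
    rw [Suf2Star_eq_of_mem h1]
    refine subset_antisymm ?_ (Set.singleton_subset_iff.mpr h1)
    intro v hv
    obtain ⟨s, t, rfl⟩ := exists_pair_of_mem_Suf_two hv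
    obtain ⟨hs, ht, h1, h2⟩ := wordNorm_lt_of_mem_Suf_two hv
    rw [S_eq ha] at hs ht
    rw [n_a] at h1 h2
    rcases ht with rfl | rfl | rfl
    · rw [r_inv] at h1; omega
    · rw [mul_inv_cancel_right] at h2
      rcases hs with rfl | rfl | rfl
      · rw [r_inv] at h2; omega
      · simp
      · rw [inv_inv] at h2; omega
    · rw [inv_inv] at h1; omega

end PSL2Z
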